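/- Let E be a real inner product space, let V ∈ E with ‖V‖ = 1, let a ∈ (0,1) and t > 0. If X ∈ E satisfies X ≠ 0, X − t•V ≠ 0 and ⟨X, V⟩ ≤ a‖X‖, then ⟨X − t•V, V⟩ ≤ a‖X − t•V‖. (In other words, the complement of the open cone C_{V,a} is invariant under translation by −tV.) -/

import Mathlib

open scoped RealInnerProductSpace

/-- The complement of the open cone `C_{V,a}` is invariant under translation by `-t • V`. -/
theorem stmt0 {E : Type*} [NormedAddCommGroup E] [InnerProductSpace ℝ E]
    (V : E) (hV : ‖V‖ = 1) (a t : ℝ) (ha : a ∈ Set.Ioo (0 : ℝ) 1) (ht : 0 < t)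
    (X : E) (hX : X ≠ 0) (hXt : X - t • V ≠ 0)
    (h : ⟪X, V⟫ ≤ a * ‖X‖) : ⟪X - t • V, V⟫ ≤ a * ‖X - t • V‖ := by
  have hnorm : ‖X‖ ≤ ‖X - t • V‖ + t := by
    simpa [norm_smul, hV, abs_of_pos ht] using norm_add_le (X - t • V) (t • V)
  have hinner : ⟪X - t • V, V⟫ = ⟪X, V⟫ - t := by
    simp [inner_sub_left, real_inner_smul_left, hV]
  calc ⟪X - t • V, V⟫ = ⟪X, V⟫ - t := hinner
    _ ≤ a * ‖X‖ - t := by gcongr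
    _ ≤ a * (‖X - t • V‖ + t) - t := by gcongr; exact ha.1.le
    _ ≤ a * ‖X - t • V‖ := by linarith [mul_le_of_le_one_left ht.le ha.2.le]
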